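/- The bouquet X = ⋃_{n≥2} C_n of countably many simple closed curves joined at p = (0,0) has discrete topological fundamental group π₁(X,p); moreover π₁(X,p) is a free group on countably infinitely many generators. -/

import Mathlib

open unitInterval Topology

noncomputable section

/-- The topological fundamental group: path components of the based loop space
(compact-open topology), with the quotient topology. -/
def piTop (Z : Type*) [TopologicalSpace Z] (z : Z) : Type _ :=
  Quotient (pathSetoid (Path z z))

instance (Z : Type*) [TopologicalSpace Z] (z : Z) : TopologicalSpace (piTop Z z) :=
  instTopologicalSpaceQuotient

/-- The class of a loop in the topological fundamental group. -/
def piMk {Z : Type*} [TopologicalSpace Z] {z : Z} (γ : Path z z) : piTop Z z :=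
  Quotient.mk _ γ

/-- The common basepoint `p = (0,0)`. -/
def pp : ℝ × ℝ := (0, 0)

/-- The apex `(1/n, 1)` of the `n`-th triangle. -/
def apex (n : ℕ) : ℝ × ℝ := (1 / (n : ℝ), 1)

/-- The third vertex `(1/n,1) + 10^{-10n}·(n,-1)` of the `n`-th triangle. -/
def apex' (n : ℕ) : ℝ × ℝ := apex n + (((10 : ℝ) ^ (10 * n))⁻¹) • ((n : ℝ), -1)

/-- The boundary of the `n`-th triangle, i.e. the union of its three edges. -/
def Cset (n : ℕ) : Set (ℝ × ℝ) :=
  segment ℝ pp (apex n) ∪ segment ℝ (apex n) (apex' n) ∪ segment ℝ (apex' n) pp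

/-- The bouquet `X = ⋃_{n ≥ 2} C_n`. -/
def Xset : Set (ℝ × ℝ) := ⋃ n ∈ {n : ℕ | 2 ≤ n}, Cset n

/-- The segment `α` from `(0,0)` to `(0,1)`. -/
def alphaSet : Set (ℝ × ℝ) := segment ℝ (0, 0) (0, 1)

/-- The compactification `Y = X ∪ α`. -/
def Yset : Set (ℝ × ℝ) := Xset ∪ alphaSet

lemma pp_mem_C (n : ℕ) : pp ∈ Cset n := Or.inl (Or.inl (left_mem_segment ℝ _ _))

lemma pp_mem_X : pp ∈ Xset :=
  Set.mem_biUnion (by norm_num : (2 : ℕ) ∈ {n : ℕ | 2 ≤ n}) (pp_mem_C 2)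

lemma X_sub_Y : Xset ⊆ Yset := Set.subset_union_left

lemma pp_mem_Y : pp ∈ Yset := X_sub_Y pp_mem_X

/-- The basepoint of `X`. -/
def pX : ↥Xset := ⟨pp, pp_mem_X⟩

/-- The basepoint of `Y`. -/
def pY : ↥Yset := ⟨pp, pp_mem_Y⟩

/-- The inclusion `X ↪ Y` as a continuous map between subspaces. -/
def jXY : C(↥Xset, ↥Yset) := ⟨Set.inclusion X_sub_Y, continuous_inclusion X_sub_Y⟩

lemma jXY_pX : jXY pX = pY := rfl

/-- Abstract data of a bouquet of arcs. -/
structure Bouq (X : Type) [TopologicalSpace X] (p : X) where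
  lp : ℕ → Path p p
  A : Set X
  A_open : IsOpen A
  pA : p ∈ A
  A_sc : IsSimplyConnected A
  V : ℕ → Set X
  V_def : ∀ n x, x ∈ V n ↔ ∃ s : I, 0 < (s : ℝ) ∧ (s : ℝ) < 1 ∧ lp n s = x
  V_open : ∀ n, IsOpen (V n)
  V_sc : ∀ n, IsSimplyConnected (V n)
  V_disj : ∀ n m x, x ∈ V n → x ∈ V m → n = m
  cover : ∀ x, x ∈ A ∨ ∃ n, x ∈ V n
  inj : ∀ n (s t : I), 0 < (s : ℝ) → (s : ℝ) < 1 → 0 < (t : ℝ) → (t : ℝ) < 1 → lp n s = lp n t → s = t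
  L_open : ∀ n, IsOpen {x | ∃ s : I, 0 < (s : ℝ) ∧ (s : ℝ) < 1 / 2 ∧ lp n s = x}
  R_open : ∀ n, IsOpen {x | ∃ s : I, 1 / 2 < (s : ℝ) ∧ (s : ℝ) < 1 ∧ lp n s = x}
  mid : ∀ n (s : I), (s : ℝ) = 1 / 2 → lp n s ∉ A
  left : ∀ n (s t : I), lp n s ∈ A → (s : ℝ) < 1 / 2 → t ≤ s → lp n t ∈ A
  right : ∀ n (s t : I), lp n s ∈ A → 1 / 2 < (s : ℝ) → s ≤ t → lp n t ∈ A

namespace Bouq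

open CategoryTheory

section paths
variable {X : Type} [TopologicalSpace X]

/-- Class of a path as an arrow. -/
def cl {x y : X} (γ : Path x y) : FundamentalGroupoid.mk x ⟶ FundamentalGroupoid.mk y :=
  Path.Homotopic.Quotient.mk γ

lemma cl_eq {x y : X} {γ δ : Path x y} (h : γ.Homotopic δ) : cl γ = cl δ :=
  Path.Homotopic.Quotient.eq.2 h

lemma cl_trans {x y z : X} (γ : Path x y) (δ : Path y z) : cl (γ.trans δ) = cl γ ≫ cl δ := rfl

lemma cl_refl (x : X) : cl (Path.refl x) = 𝟙 _ := rfl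

lemma cl_eq_of_mem {S : Set X} (hS : IsSimplyConnected S) {x y : X} (γ δ : Path x y)
    (hγ : ∀ t, γ t ∈ S) (hδ : ∀ t, δ t ∈ S) : cl γ = cl δ := by
  have hx : x ∈ S := by simpa using hγ 0
  have hy : y ∈ S := by simpa using hγ 1
  let γ' : Path (⟨x, hx⟩ : S) ⟨y, hy⟩ :=
    { toFun := fun t => ⟨γ t, hγ t⟩
      source' := by simp
      target' := by simp }
  let δ' : Path (⟨x, hx⟩ : S) ⟨y, hy⟩ :=
    { toFun := fun t => ⟨δ t, hδ t⟩
      source' := by simp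
      target' := by simp }
  have := hS.simplyConnectedSpace
  have h := SimplyConnectedSpace.paths_homotopic γ' δ'
  have h2 := h.map ⟨Subtype.val, continuous_subtype_val⟩
  exact cl_eq h2

/-- The initial part of a path. -/
def ini {x y : X} (γ : Path x y) (t : I) : Path x (γ t) := (γ.subpath 0 t).cast γ.source.symm rfl

lemma ini_trans {x y : X} (γ : Path x y) (t s : I) :
    cl (ini γ t) ≫ cl (γ.subpath t s) = cl (ini γ s) := by
  rw [← cl_trans]
  apply cl_eq
  have h : ((γ.subpath 0 t).trans (γ.subpath t s)).Homotopic (γ.subpath 0 s) :=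
    ⟨Path.Homotopy.subpathTransSubpath γ 0 t s⟩
  have h2 := h.pathCast γ.source.symm rfl
  exact h2

lemma subpath_mem {x y : X} (γ : Path x y) (t s : I) (S : Set X)
    (h : ∀ u, min t s ≤ u → u ≤ max t s → γ u ∈ S) (v : I) : γ.subpath t s v ∈ S := by
  have : γ.subpath t s v ∈ Set.range (γ.subpath t s) := ⟨v, rfl⟩
  rw [Path.range_subpath] at this
  obtain ⟨u, hu, hu2⟩ := this
  rw [← hu2]
  exact h u hu.1 hu.2

lemma ini_one {x y : X} (γ : Path x y) : (ini γ 1).cast rfl γ.target.symm = γ := by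
  ext t
  simp [ini, Path.subpath]

lemma ini_zero {x y : X} (γ : Path x y) : (ini γ 0).cast rfl γ.source.symm = Path.refl x := by
  ext t
  simp [ini, Path.subpath]

end paths

variable {X : Type} [TopologicalSpace X] {p : X} (B : Bouq X p)

/-- The comparison homomorphism. -/
def psi : FreeGroup ℕ →* End (FundamentalGroupoid.mk p) := FreeGroup.lift fun n => cl (B.lp n)

/-- equality modulo the range. -/
def Rel {x : X} (f g : FundamentalGroupoid.mk p ⟶ FundamentalGroupoid.mk x) : Prop :=
  ∃ w, f = B.psi w ≫ g

variable {B}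

lemma Rel.refl {x : X} (f : FundamentalGroupoid.mk p ⟶ FundamentalGroupoid.mk x) : B.Rel f f :=
  ⟨1, by rw [map_one, End.one_def, Category.id_comp]⟩

lemma Rel.symm {x : X} {f g : FundamentalGroupoid.mk p ⟶ FundamentalGroupoid.mk x}
    (h : B.Rel f g) : B.Rel g f := by
  obtain ⟨w, rfl⟩ := h
  refine ⟨w⁻¹, ?_⟩
  rw [← Category.assoc, ← End.mul_def, ← map_mul, mul_inv_cancel, map_one, End.one_def, Category.id_comp]

lemma Rel.trans {x : X} {f g h : FundamentalGroupoid.mk p ⟶ FundamentalGroupoid.mk x}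
    (h1 : B.Rel f g) (h2 : B.Rel g h) : B.Rel f h := by
  obtain ⟨w, rfl⟩ := h1
  obtain ⟨v, rfl⟩ := h2
  exact ⟨v * w, by rw [map_mul, End.mul_def, Category.assoc]⟩

lemma Rel.comp {x y : X} {f g : FundamentalGroupoid.mk p ⟶ FundamentalGroupoid.mk x}
    (h1 : B.Rel f g) (d : FundamentalGroupoid.mk x ⟶ FundamentalGroupoid.mk y) :
    B.Rel (f ≫ d) (g ≫ d) := by
  obtain ⟨w, rfl⟩ := h1
  exact ⟨w, by rw [Category.assoc]⟩

variable (B)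

/-- Basic arrows. -/
def Basic (x : X) (f : FundamentalGroupoid.mk p ⟶ FundamentalGroupoid.mk x) : Prop :=
  (∃ r : Path p x, (∀ t, r t ∈ B.A) ∧ f = cl r) ∨
  (∃ (n : ℕ) (s : I) (_ : 0 < (s : ℝ)) (_ : (s : ℝ) < 1) (h : B.lp n s = x),
    f = cl ((ini (B.lp n) s).cast rfl h.symm))

lemma compare (n : ℕ) (s : I) (r : Path p (B.lp n s)) (hr : ∀ t, r t ∈ B.A) :
    B.Rel (cl (ini (B.lp n) s)) (cl r) := by
  have hA : B.lp n s ∈ B.A := by simpa using hr 1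
  rcases lt_trichotomy (s : ℝ) (1 / 2) with h | h | h
  · rw [cl_eq_of_mem B.A_sc (ini (B.lp n) s) r _ hr]
    · exact Rel.refl _
    · intro t
      refine subpath_mem (B.lp n) 0 s B.A ?_ t
      intro u _ hu
      exact B.left n s u hA h (by simpa using hu)
  · exact absurd hA (B.mid n s h)
  · refine ⟨FreeGroup.of n, ?_⟩
    have h1 := ini_trans (B.lp n) s 1
    have h2 : cl r ≫ cl (((B.lp n).subpath s 1).cast rfl (B.lp n).target.symm) = 𝟙 _ := by
      rw [← cl_trans, ← cl_refl]
      apply cl_eq_of_mem B.A_sc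
      · intro t
        have : (r.trans (((B.lp n).subpath s 1).cast rfl (B.lp n).target.symm)) t ∈ Set.range (r.trans (((B.lp n).subpath s 1).cast rfl (B.lp n).target.symm)) := ⟨t, rfl⟩
        rw [Path.trans_range] at this
        rcases this with ⟨u, hu⟩ | ⟨u, hu⟩
        · rw [← hu]; exact hr u
        · rw [← hu]
          refine subpath_mem (B.lp n) s 1 B.A ?_ u
          intro v hv _
          refine B.right n s v hA h ?_
          simpa [unitInterval.le_one'] using hv
      · intro t; exact B.pA
    have h3 : cl (ini (B.lp n) s) ≫ cl (((B.lp n).subpath s 1).cast rfl (B.lp n).target.symm) = cl (B.lp n) := by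
      have h4 : (((B.lp n).subpath 0 s).trans ((B.lp n).subpath s 1)).Homotopic ((B.lp n).subpath 0 1) :=
        ⟨Path.Homotopy.subpathTransSubpath (B.lp n) 0 s 1⟩
      have h5 := h4.pathCast (B.lp n).source.symm (B.lp n).target.symm
      have h6 := cl_eq h5
      rw [← cl_trans]
      refine Eq.trans h6 ?_
      congr 1
      ext t
      simp [Path.subpath]
    rw [← cancel_mono (cl (((B.lp n).subpath s 1).cast rfl (B.lp n).target.symm)), h3, Category.assoc, h2,
      Category.comp_id, psi, FreeGroup.lift_apply_of]

lemma basic_rel (x : X) (f g) (hf : B.Basic x f) (hg : B.Basic x g) : B.Rel f g := by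
  rcases hf with ⟨r, hr, rfl⟩ | ⟨n, s, h0, h1, rfl, rfl⟩
  · rcases hg with ⟨r', hr', rfl⟩ | ⟨n, s, h0, h1, rfl, rfl⟩
    · rw [cl_eq_of_mem B.A_sc r r' hr hr']; exact Rel.refl _
    · exact (compare B n s r hr).symm
  · rcases hg with ⟨r', hr', rfl⟩ | ⟨m, t, h0', h1', h, rfl⟩
    · exact compare B n s r' hr'
    · have hnm := B.V_disj m n _ ((B.V_def m _).2 ⟨t, h0', h1', h⟩) ((B.V_def n _).2 ⟨s, h0, h1, rfl⟩)
      subst hnm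
      have := B.inj m t s h0' h1' h0 h1 h
      subst this
      exact Rel.refl _

/-- Good arrows. -/
def Good (x : X) (f : FundamentalGroupoid.mk p ⟶ FundamentalGroupoid.mk x) : Prop :=
  ∃ b, B.Basic x b ∧ B.Rel f b

lemma good_step {x y : X} (δ : Path x y)
    (h : (∀ t, δ t ∈ B.A) ∨ ∃ n, ∀ t, δ t ∈ B.V n) (f : FundamentalGroupoid.mk p ⟶ FundamentalGroupoid.mk x)
    (hf : B.Good x f) : B.Good y (f ≫ cl δ) := by
  suffices H : ∃ b, B.Basic x b ∧ B.Basic y (b ≫ cl δ) by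
    obtain ⟨b, hb, hb2⟩ := H
    obtain ⟨b0, hb0, hr⟩ := hf
    exact ⟨_, hb2, (hr.trans (basic_rel B x b0 b hb0 hb)).comp _⟩
  rcases h with h | ⟨n, h⟩
  · have hx : x ∈ B.A := by simpa using h 0
    have hj := B.A_sc.isPathConnected.joinedIn p B.pA x hx
    refine ⟨cl hj.somePath, Or.inl ⟨_, hj.somePath_mem, rfl⟩, Or.inl ⟨hj.somePath.trans δ, ?_, rfl⟩⟩
    intro t
    have : (hj.somePath.trans δ) t ∈ Set.range (hj.somePath.trans δ) := ⟨t, rfl⟩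
    rw [Path.trans_range] at this
    rcases this with ⟨u, hu⟩ | ⟨u, hu⟩
    · rw [← hu]; exact hj.somePath_mem u
    · rw [← hu]; exact h u
  · have hx : x ∈ B.V n := by simpa using h 0
    have hy : y ∈ B.V n := by simpa using h 1
    obtain ⟨s, h0, h1, rfl⟩ := (B.V_def n x).1 hx
    obtain ⟨t, h0', h1', rfl⟩ := (B.V_def n y).1 hy
    refine ⟨cl (ini (B.lp n) s), Or.inr ⟨n, s, h0, h1, rfl, rfl⟩, Or.inr ⟨n, t, h0', h1', rfl, ?_⟩⟩
    rw [cl_eq_of_mem (B.V_sc n) δ ((B.lp n).subpath s t) h, ini_trans]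
    · rfl
    · refine subpath_mem (B.lp n) s t _ ?_
      intro u hu hu2
      refine (B.V_def n _).2 ⟨u, ?_, ?_, rfl⟩
      · have : 0 < min s t := lt_min h0 h0'
        exact lt_of_lt_of_le this hu
      · have : max s t < 1 := max_lt h1 h1'
        exact lt_of_le_of_lt hu2 this

lemma good_cast {x y : X} (h : y = x) (q : Path p x) (hg : B.Good x (cl q)) :
    B.Good y (cl (q.cast rfl h)) := by
  subst h; exact hg

lemma good_loop (γ : Path p p) : B.Good p (cl γ) := by
  have key : IsLocallyConstant (fun t : I => B.Good (γ t) (cl (ini γ t))) := by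
    rw [IsLocallyConstant.iff_eventually_eq]
    intro t
    have : ∃ S : Set X, IsOpen S ∧ γ t ∈ S ∧ (S ⊆ B.A ∨ ∃ n, S ⊆ B.V n) := by
      rcases B.cover (γ t) with h | ⟨n, h⟩
      · exact ⟨_, B.A_open, h, Or.inl le_rfl⟩
      · exact ⟨_, B.V_open n, h, Or.inr ⟨n, le_rfl⟩⟩
    obtain ⟨S, hS, htS, hSS⟩ := this
    obtain ⟨ε, hε, hball⟩ := Metric.isOpen_iff.1 (hS.preimage γ.continuous) t htS
    filter_upwards [Metric.ball_mem_nhds t hε] with s hs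
    have hin : ∀ u, min t s ≤ u → u ≤ max t s → γ u ∈ S := by
      intro u h1 h2
      apply hball
      rw [Metric.mem_ball, Subtype.dist_eq, Real.dist_eq] at *
      rw [abs_lt] at *
      rcases le_total t s with h | h
      · rw [min_eq_left h] at h1
        rw [max_eq_right h] at h2
        have h1' : (t : ℝ) ≤ u := h1
        have h2' : (u : ℝ) ≤ s := h2
        constructor <;> linarith
      · rw [min_eq_right h] at h1
        rw [max_eq_left h] at h2
        have h1' : (s : ℝ) ≤ u := h1
        have h2' : (u : ℝ) ≤ t := h2
        constructor <;> linarith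
    have hd1 := subpath_mem γ t s S hin
    have hd2 := subpath_mem γ s t S (by rw [min_comm, max_comm]; exact hin)
    have c1 : (∀ v, γ.subpath t s v ∈ B.A) ∨ ∃ n, ∀ v, γ.subpath t s v ∈ B.V n :=
      hSS.imp (fun h v => h (hd1 v)) (fun ⟨n, h⟩ => ⟨n, fun v => h (hd1 v)⟩)
    have c2 : (∀ v, γ.subpath s t v ∈ B.A) ∨ ∃ n, ∀ v, γ.subpath s t v ∈ B.V n :=
      hSS.imp (fun h v => h (hd2 v)) (fun ⟨n, h⟩ => ⟨n, fun v => h (hd2 v)⟩)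
    apply propext
    constructor
    · intro h
      have := good_step B _ c2 _ h
      rwa [ini_trans] at this
    · intro h
      have := good_step B _ c1 _ h
      rwa [ini_trans] at this
  have h01 := key.apply_eq_of_preconnectedSpace 0 1
  have h0 : B.Good (γ 0) (cl (ini γ 0)) := by
    refine ⟨_, Or.inl ⟨ini γ 0, ?_, rfl⟩, Rel.refl _⟩
    intro t
    have : ini γ 0 t = p := by simp [ini, Path.subpath]
    rw [this]; exact B.pA
  have h1 : B.Good (γ 1) (cl (ini γ 1)) := h01 ▸ h0
  have := good_cast B γ.target.symm _ h1
  rwa [ini_one] at this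

lemma psi_surj : Function.Surjective B.psi := by
  intro f
  obtain ⟨γ, rfl⟩ := Path.Homotopic.Quotient.mk_surjective f
  obtain ⟨b, hb, hr⟩ := good_loop B γ
  obtain ⟨w, hw⟩ := hr.trans (basic_rel B p b (cl (Path.refl p)) hb
    (Or.inl ⟨_, fun t => B.pA, rfl⟩))
  rw [cl_refl, Category.comp_id] at hw
  exact ⟨w, hw.symm⟩


open Classical in
/-- Transition data: `1` on the left part, the generator on the right part. -/
def u (i : Option ℕ) (x : X) : FreeGroup ℕ :=
  match i with
  | none => 1
  | some n => if ∃ s : I, 1 / 2 < (s : ℝ) ∧ (s : ℝ) < 1 ∧ B.lp n s = x then FreeGroup.of n else 1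

/-- The base sets. -/
def bs (i : Option ℕ) : Set X :=
  match i with
  | none => B.A
  | some n => B.V n

lemma u_right (n : ℕ) (s : I) (h0 : 1 / 2 < (s : ℝ)) (h1 : (s : ℝ) < 1) :
    B.u (some n) (B.lp n s) = FreeGroup.of n := by
  simp only [u]
  rw [if_pos ⟨s, h0, h1, rfl⟩]

lemma u_left (n : ℕ) (s : I) (h0 : 0 < (s : ℝ)) (h1 : (s : ℝ) < 1 / 2) :
    B.u (some n) (B.lp n s) = 1 := by
  simp only [u]
  rw [if_neg]
  rintro ⟨t, h2, h3, h4⟩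
  have := B.inj n t s (by linarith) h3 h0 (by linarith) h4
  subst this
  linarith

lemma u_loc (n : ℕ) (x : X) (hA : x ∈ B.A) (hV : x ∈ B.V n) :
    ∀ᶠ y in 𝓝 x, B.u (some n) y = B.u (some n) x := by
  obtain ⟨s, h0, h1, rfl⟩ := (B.V_def n x).1 hV
  rcases lt_trichotomy (s : ℝ) (1 / 2) with h | h | h
  · filter_upwards [(B.L_open n).mem_nhds ⟨s, h0, h, rfl⟩]
    rintro y ⟨t, h2, h3, rfl⟩
    rw [u_left _ _ _ h0 h, u_left _ _ _ h2 h3]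
  · exact absurd hA (B.mid n s h)
  · filter_upwards [(B.R_open n).mem_nhds ⟨s, h, h1, rfl⟩]
    rintro y ⟨t, h2, h3, rfl⟩
    rw [u_right _ _ _ h h1, u_right _ _ _ h2 h3]

lemma u_loc2 (i j : Option ℕ) (x : X) (hi : x ∈ B.bs i) (hj : x ∈ B.bs j) :
    ∀ᶠ y in 𝓝 x, (B.u j y)⁻¹ * B.u i y = (B.u j x)⁻¹ * B.u i x := by
  match i, j, hi, hj with
  | none, none, _, _ => exact Filter.Eventually.of_forall fun y => rfl
  | none, some n, hA, hV =>
    filter_upwards [B.u_loc n x hA hV] with y hy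
    rw [hy]; rfl
  | some n, none, hV, hA =>
    filter_upwards [B.u_loc n x hA hV] with y hy
    rw [hy]; rfl
  | some n, some m, h1, h2 =>
    have := B.V_disj n m x h1 h2
    subst this
    simp

instance : TopologicalSpace (FreeGroup ℕ) := ⊥
instance : DiscreteTopology (FreeGroup ℕ) := ⟨rfl⟩

open Classical in
/-- The universal cover as a fiber bundle core. -/
def core : FiberBundleCore (Option ℕ) X (FreeGroup ℕ) where
  baseSet := B.bs
  isOpen_baseSet i := by
    cases i
    · exact B.A_open
    · exact B.V_open _
  indexAt x := if h : x ∈ B.A then none else some ((B.cover x).resolve_left h).choose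
  mem_baseSet_at x := by
    by_cases h : x ∈ B.A
    · rw [dif_pos h]; exact h
    · rw [dif_neg h]; exact ((B.cover x).resolve_left h).choose_spec
  coordChange i j x g := (B.u j x)⁻¹ * B.u i x * g
  coordChange_self i x _ g := by simp
  continuousOn_coordChange i j := by
    rintro ⟨x, g⟩ ⟨⟨hi, hj⟩, -⟩
    apply ContinuousAt.continuousWithinAt
    rw [ContinuousAt, nhds_discrete (FreeGroup ℕ), Filter.tendsto_pure, nhds_prod_eq,
      nhds_discrete (FreeGroup ℕ)]
    filter_upwards [(B.u_loc2 i j x hi hj).prod_mk (Filter.eventually_pure.2 (rfl : g = g) :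
      ∀ᶠ y in pure g, y = g)]
    rintro ⟨y, g'⟩ ⟨h1, h2⟩
    dsimp only at h1 h2 ⊢
    rw [h1, h2]
  coordChange_comp i j k x _ g := by group

/-- The total space. -/
abbrev E := Bundle.TotalSpace (FreeGroup ℕ) B.core.Fiber

lemma cov : IsCoveringMap (Bundle.TotalSpace.proj : B.E → X) :=
  FiberBundle.isCoveringMap

/-- Coordinate in chart `i`. -/
def co (i : Option ℕ) (e : B.E) : FreeGroup ℕ := (B.core.localTriv i e).2

lemma co_cont (i : Option ℕ) (e : B.E) (h : e.proj ∈ B.bs i) : ContinuousAt (B.co i) e := by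
  have h1 : e ∈ (B.core.localTriv i).source := h
  exact continuous_snd.continuousAt.comp ((B.core.localTriv i).continuousAt h1)

lemma co_change (i j : Option ℕ) (e : B.E) (hi : e.proj ∈ B.bs i) (hj : e.proj ∈ B.bs j) :
    B.co j e = (B.u j e.proj)⁻¹ * B.u i e.proj * B.co i e := by
  have h := B.core.coordChange_comp (B.core.indexAt e.proj) i j e.proj
    ⟨⟨B.core.mem_baseSet_at _, hi⟩, hj⟩ e.2
  exact h.symm

lemma co_inj (i : Option ℕ) (e e' : B.E) (h : e.proj = e'.proj) (hi : e.proj ∈ B.bs i)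
    (hc : B.co i e = B.co i e') : e = e' := by
  have h1 : e ∈ (B.core.localTriv i).source := hi
  have h2 : e' ∈ (B.core.localTriv i).source := by
    change e'.proj ∈ B.bs i
    rw [← h]; exact hi
  exact (B.core.localTriv i).injOn h1 h2 (Prod.ext h hc)

lemma co_const (i : Option ℕ) (Γ : C(I, B.E)) (a b : I) (hab : a ≤ b)
    (h : ∀ t, a ≤ t → t ≤ b → (Γ t).proj ∈ B.bs i) : B.co i (Γ a) = B.co i (Γ b) := by
  have hp : _root_.IsPreconnected (Set.Icc a b) := isPreconnected_Icc
  refine hp.constant (f := fun t => B.co i (Γ t)) ?_ ⟨le_rfl, hab⟩ ⟨hab, le_rfl⟩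
  intro t ht
  apply ContinuousAt.continuousWithinAt
  exact (B.co_cont i (Γ t) (h t ht.1 ht.2)).comp Γ.continuous.continuousAt

lemma ex_left (n : ℕ) : ∃ s : I, 0 < (s : ℝ) ∧ (s : ℝ) < 1 / 2 ∧ B.lp n s ∈ B.A := by
  have h : (B.lp n) ⁻¹' B.A ∈ 𝓝 (0 : I) :=
    (B.A_open.preimage (B.lp n).continuous).mem_nhds (by simpa using B.pA)
  obtain ⟨ε, hε, hb⟩ := Metric.mem_nhds_iff.1 h
  have h1 : 0 < min (ε / 2) (1 / 4) := lt_min (by linarith) (by norm_num)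
  have h2 : min (ε / 2) (1 / 4) ≤ 1 / 4 := min_le_right _ _
  have h3 : min (ε / 2) (1 / 4) ≤ ε / 2 := min_le_left _ _
  refine ⟨⟨min (ε / 2) (1 / 4), h1.le, by linarith⟩, h1, by dsimp only; linarith, hb ?_⟩
  rw [Metric.mem_ball, Subtype.dist_eq, Real.dist_eq]
  simp only [Set.Icc.coe_zero, sub_zero]
  rw [abs_of_pos h1]; linarith

lemma ex_right (n : ℕ) : ∃ s : I, 1 / 2 < (s : ℝ) ∧ (s : ℝ) < 1 ∧ B.lp n s ∈ B.A := by
  have h : (B.lp n) ⁻¹' B.A ∈ 𝓝 (1 : I) :=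
    (B.A_open.preimage (B.lp n).continuous).mem_nhds (by simpa using B.pA)
  obtain ⟨ε, hε, hb⟩ := Metric.mem_nhds_iff.1 h
  have h1 : 0 < min (ε / 2) (1 / 4) := lt_min (by linarith) (by norm_num)
  have h2 : min (ε / 2) (1 / 4) ≤ 1 / 4 := min_le_right _ _
  have h3 : min (ε / 2) (1 / 4) ≤ ε / 2 := min_le_left _ _
  refine ⟨⟨1 - min (ε / 2) (1 / 4), by linarith, by linarith⟩, by dsimp only; linarith,
    by dsimp only; linarith, hb ?_⟩
  rw [Metric.mem_ball, Subtype.dist_eq, Real.dist_eq]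
  simp only [Set.Icc.coe_one]
  rw [abs_sub_comm, sub_sub_cancel, abs_of_pos h1]; linarith

lemma lift_lp (n : ℕ) (Γ : C(I, B.E)) (hΓ : ∀ t, (Γ t).proj = B.lp n t) :
    B.co none (Γ 1) = FreeGroup.of n * B.co none (Γ 0) := by
  obtain ⟨a, ha0, ha1, haA⟩ := B.ex_left n
  obtain ⟨b, hb0, hb1, hbA⟩ := B.ex_right n
  have haV : B.lp n a ∈ B.V n := (B.V_def n _).2 ⟨a, ha0, by linarith, rfl⟩
  have hbV : B.lp n b ∈ B.V n := (B.V_def n _).2 ⟨b, by linarith, hb1, rfl⟩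
  have hab : a ≤ b := by
    have : (a : ℝ) ≤ b := by linarith
    exact this
  have e1 : B.co none (Γ 0) = B.co none (Γ a) := by
    refine B.co_const none Γ 0 a unitInterval.nonneg' ?_
    intro t _ ht
    rw [hΓ]; exact B.left n a t haA ha1 ht
  have e2 : B.co (some n) (Γ a) = B.co (some n) (Γ b) := by
    refine B.co_const (some n) Γ a b hab ?_
    intro t h1 h2
    rw [hΓ]
    have h1' : (a : ℝ) ≤ t := h1
    have h2' : (t : ℝ) ≤ b := h2
    exact (B.V_def n _).2 ⟨t, by linarith, by linarith, rfl⟩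
  have e3 : B.co none (Γ b) = B.co none (Γ 1) := by
    refine B.co_const none Γ b 1 unitInterval.le_one' ?_
    intro t ht _
    rw [hΓ]; exact B.right n b t hbA hb0 ht
  have c1 := B.co_change none (some n) (Γ a) (by rw [hΓ]; exact haA) (by rw [hΓ]; exact haV)
  have c2 := B.co_change (some n) none (Γ b) (by rw [hΓ]; exact hbV) (by rw [hΓ]; exact hbA)
  rw [hΓ, B.u_left n a ha0 ha1] at c1
  rw [hΓ, B.u_right n b hb0 hb1] at c2
  rw [← e3, c2, ← e2, c1, e1]
  simp [u]

lemma mono_lp (n : ℕ) (e : (Bundle.TotalSpace.proj : B.E → X) ⁻¹' {p}) :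
    B.co none (B.cov.monodromy (cl (B.lp n)) e).1 = FreeGroup.of n * B.co none e.1 := by
  have h0 : (B.lp n : C(I, X)) 0 = (e : B.E).proj := (B.lp n).source.trans e.2.symm
  have h := B.lift_lp n (B.cov.liftPath (B.lp n) e.1 h0)
    (fun t => congrFun (B.cov.liftPath_lifts (B.lp n) e.1 h0) t)
  rw [B.cov.liftPath_zero] at h
  exact h

lemma mono_psi (w : FreeGroup ℕ) : ∀ e : (Bundle.TotalSpace.proj : B.E → X) ⁻¹' {p},
    B.co none (B.cov.monodromyPerm p (B.psi w) e).1 = w * B.co none e.1 := by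
  induction w using FreeGroup.induction_on with
  | C1 => intro e; rw [map_one, map_one, one_mul]; rfl
  | of n =>
    intro e
    have := B.mono_lp n e
    rw [psi, FreeGroup.lift_apply_of]
    exact this
  | inv_of n ih =>
    intro e
    have := ih ((B.cov.monodromyPerm p (B.psi (FreeGroup.of n)))⁻¹ e)
    rw [← Equiv.Perm.mul_apply, mul_inv_cancel, Equiv.Perm.one_apply] at this
    rw [map_inv, map_inv, this]
    simp
  | mul x y hx hy =>
    intro e
    rw [map_mul, map_mul, Equiv.Perm.mul_apply, hx, hy, mul_assoc]

/-- Base point of the cover. -/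
def e0 : (Bundle.TotalSpace.proj : B.E → X) ⁻¹' {p} := ⟨⟨p, (1 : FreeGroup ℕ)⟩, rfl⟩

/-- The winding word of a loop. -/
def Phi (γ : Path p p) : FreeGroup ℕ :=
  B.co none (B.cov.monodromy (cl γ) B.e0).1 * (B.co none B.e0.1)⁻¹

lemma Phi_psi (w : FreeGroup ℕ) (γ : Path p p) (h : B.psi w = cl γ) : B.Phi γ = w := by
  have := B.mono_psi w B.e0
  rw [h] at this
  unfold Phi
  exact mul_inv_eq_iff_eq_mul.2 this

lemma Phi_cont : Continuous B.Phi := by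
  let H : C(I × Path p p, X) := ⟨fun q => q.2 q.1, by fun_prop⟩
  have H0 : ∀ γ, H (0, γ) = (ContinuousMap.const (Path p p) B.e0.1 γ).proj := fun γ => γ.source
  have hc := (B.cov.liftHomotopy H (ContinuousMap.const _ B.e0.1) H0).continuous
  have key : ∀ γ, (B.cov.monodromy (cl γ) B.e0).1 =
      B.cov.liftHomotopy H (ContinuousMap.const _ B.e0.1) H0 (1, γ) := fun γ => rfl
  unfold Phi
  refine (continuous_of_discreteTopology (f := fun g : FreeGroup ℕ =>
    g * (B.co none B.e0.1)⁻¹)).comp (?_ : Continuous fun γ => B.co none (B.cov.monodromy (cl γ) B.e0).1)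
  simp_rw [key]
  rw [continuous_iff_continuousAt]
  intro γ
  have hmem : (B.cov.liftHomotopy H (ContinuousMap.const _ B.e0.1) H0 (1, γ)).proj ∈ B.bs none := by
    rw [← key]
    rw [(B.cov.monodromy (cl γ) B.e0).2]
    exact B.pA
  exact ContinuousAt.comp (f := fun γ => B.cov.liftHomotopy H (ContinuousMap.const _ B.e0.1) H0 (1, γ))
    (B.co_cont none _ hmem) (hc.comp (by fun_prop)).continuousAt

lemma psi_inj : Function.Injective B.psi := by
  intro w v h
  obtain ⟨γ, hγ⟩ := Path.Homotopic.Quotient.mk_surjective (B.psi w)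
  rw [← B.Phi_psi w γ hγ.symm, ← B.Phi_psi v γ (h ▸ hγ.symm)]

lemma psi_Phi (γ : Path p p) : B.psi (B.Phi γ) = cl γ := by
  obtain ⟨w, hw⟩ := B.psi_surj (cl γ)
  rw [B.Phi_psi w γ hw, hw]

lemma joined_iff (γ δ : Path p p) : Joined γ δ ↔ cl γ = cl δ := by
  constructor
  · rintro ⟨F⟩
    apply cl_eq
    have hc : Continuous (fun q : I × I => F q.1 q.2) := by fun_prop
    exact ⟨{ toFun := fun q => F q.1 q.2
             continuous_toFun := hc
             map_zero_left := fun t => by simp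
             map_one_left := fun t => by simp
             prop' := fun t x hx => by
               rcases hx with rfl | rfl <;> simp }⟩
  · intro h
    obtain ⟨F⟩ := Path.Homotopic.Quotient.exact h
    refine ⟨⟨⟨fun t => F.eval t, ?_⟩, F.eval_zero, F.eval_one⟩⟩
    rw [← Path.continuous_uncurry_iff]
    exact F.continuous

theorem main (B : Bouq X p) :
    DiscreteTopology (Quotient (pathSetoid (Path p p))) ∧
    ∃ e : Quotient (pathSetoid (Path p p)) ≃ FreeGroup ℕ,
      ∀ a b : Path p p,
        e (Quotient.mk _ (a.trans b)) = e (Quotient.mk _ a) * e (Quotient.mk _ b) := by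
  have hPhi : ∀ γ δ : Path p p, B.Phi γ = B.Phi δ ↔ Joined γ δ := by
    intro γ δ
    rw [joined_iff, ← B.psi_Phi γ, ← B.psi_Phi δ]
    exact ⟨fun h => by rw [h], fun h => B.psi_inj h⟩
  have hsurj : ∀ w, ∃ γ, B.Phi γ = w := by
    intro w
    obtain ⟨γ, hγ⟩ := Path.Homotopic.Quotient.mk_surjective (B.psi w)
    exact ⟨γ, B.Phi_psi w γ hγ.symm⟩
  have hmul : ∀ a b, B.Phi (a.trans b) = B.Phi b * B.Phi a := by
    intro a b
    apply B.psi_inj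
    rw [map_mul, psi_Phi, psi_Phi, psi_Phi]
    rfl
  let f : Quotient (pathSetoid (Path p p)) → FreeGroup ℕ :=
    Quotient.lift (fun γ => (B.Phi γ)⁻¹) fun a b h => congrArg _ ((hPhi a b).2 h)
  have hf : Function.Bijective f := by
    constructor
    · intro a b
      induction a using Quotient.inductionOn
      induction b using Quotient.inductionOn
      intro h
      exact Quotient.sound ((hPhi _ _).1 (inv_injective h))
    · intro w
      obtain ⟨γ, hγ⟩ := hsurj w⁻¹
      exact ⟨Quotient.mk _ γ, by change (B.Phi γ)⁻¹ = w; rw [hγ, inv_inv]⟩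
  have hfc : Continuous f := by
    refine Continuous.quotient_lift ?_ _
    exact (continuous_of_discreteTopology (f := fun g : FreeGroup ℕ => g⁻¹)).comp B.Phi_cont
  refine ⟨DiscreteTopology.of_continuous_injective hfc hf.1, Equiv.ofBijective f hf, ?_⟩
  intro a b
  change (B.Phi (a.trans b))⁻¹ = (B.Phi a)⁻¹ * (B.Phi b)⁻¹
  rw [hmul, mul_inv_rev]

end Bouq

section geometry

/-- First barycentric coordinate of the parametrization. -/
def l1 (s : ℝ) : ℝ := max 0 (1 - |3 * s - 1|)

/-- Second barycentric coordinate of the parametrization. -/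
def l2 (s : ℝ) : ℝ := max 0 (1 - |3 * s - 2|)

lemma l_low (s : ℝ) (h0 : 0 ≤ s) (h1 : s ≤ 1 / 3) : l1 s = 3 * s ∧ l2 s = 0 := by
  constructor
  · rw [l1, abs_of_nonpos (by linarith), max_eq_right (by linarith)]; ring
  · rw [l2, abs_of_nonpos (by linarith), max_eq_left (by linarith)]

lemma l_mid (s : ℝ) (h0 : 1 / 3 ≤ s) (h1 : s ≤ 2 / 3) : l1 s = 2 - 3 * s ∧ l2 s = 3 * s - 1 := by
  constructor
  · rw [l1, abs_of_nonneg (by linarith), max_eq_right (by linarith)]; ring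
  · rw [l2, abs_of_nonpos (by linarith), max_eq_right (by linarith)]; ring

lemma l_high (s : ℝ) (h0 : 2 / 3 ≤ s) (h1 : s ≤ 1) : l1 s = 0 ∧ l2 s = 3 - 3 * s := by
  constructor
  · rw [l1, abs_of_nonneg (by linarith), max_eq_left (by linarith)]
  · rw [l2, abs_of_nonneg (by linarith), max_eq_right (by linarith)]; ring

lemma l_cases (s : ℝ) (h0 : 0 ≤ s) (h1 : s ≤ 1) :
    (s ≤ 1 / 3 ∧ l1 s = 3 * s ∧ l2 s = 0) ∨
    (1 / 3 ≤ s ∧ s ≤ 2 / 3 ∧ l1 s = 2 - 3 * s ∧ l2 s = 3 * s - 1) ∨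
    (2 / 3 ≤ s ∧ l1 s = 0 ∧ l2 s = 3 - 3 * s) := by
  rcases le_total s (1 / 3) with h | h
  · exact Or.inl ⟨h, l_low s h0 h⟩
  · rcases le_total s (2 / 3) with h' | h'
    · exact Or.inr (Or.inl ⟨h, h', l_mid s h h'⟩)
    · exact Or.inr (Or.inr ⟨h', l_high s h' h1⟩)

/-- The small parameter. -/
def eps (n : ℕ) : ℝ := ((10 : ℝ) ^ (10 * n))⁻¹

lemma eps_pos (n : ℕ) : 0 < eps n := by unfold eps; positivity

lemma eps_small (n : ℕ) (hn : 2 ≤ n) : eps n * (10 * (n : ℝ) ^ 3) ≤ 1 := by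
  unfold eps
  rw [inv_mul_le_iff₀ (by positivity), mul_one]
  have h1 : (n : ℝ) ≤ 10 ^ n := by
    exact_mod_cast (Nat.lt_pow_self (by norm_num : 1 < 10)).le
  have h2 : (10 : ℝ) ≤ 10 ^ n := by
    calc (10 : ℝ) = 10 ^ 1 := by norm_num
      _ ≤ 10 ^ n := pow_le_pow_right₀ (by norm_num) (by omega)
  have h3 : (n : ℝ) ^ 3 ≤ (10 ^ n) ^ 3 := pow_le_pow_left₀ (by positivity) h1 3
  have h4 : (10 : ℝ) ≤ (10 ^ n) ^ 7 := h2.trans (le_self_pow₀ (by linarith) (by norm_num))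
  calc 10 * (n : ℝ) ^ 3 ≤ (10 ^ n) ^ 7 * (10 ^ n) ^ 3 := by gcongr
    _ = 10 ^ (10 * n) := by rw [← pow_add, ← pow_mul, mul_comm]

lemma eps_quarter (n : ℕ) (hn : 2 ≤ n) : eps n ≤ 1 / 4 := by
  have h := eps_small n hn
  have h2 : (2 : ℝ) ≤ n := by exact_mod_cast hn
  have h3 : (2 : ℝ) ^ 3 ≤ (n : ℝ) ^ 3 := by gcongr
  have := eps_pos n
  nlinarith

/-- The parametrization of the triangle. -/
def tau (n : ℕ) (s : ℝ) : ℝ × ℝ :=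
  (l1 s * (1 / n) + l2 s * (1 / n + eps n * n), l1 s + l2 s * (1 - eps n))

lemma apex'_eq (n : ℕ) : apex' n = (1 / (n : ℝ) + eps n * n, 1 - eps n) := by
  simp [apex', apex, eps, sub_eq_add_neg]

lemma tau_eq (n : ℕ) (s : ℝ) : tau n s = l1 s • apex n + l2 s • apex' n := by
  rw [apex'_eq]
  simp [tau, apex]

lemma tau_cont (n : ℕ) : Continuous (tau n) := by
  unfold tau l1 l2
  fun_prop

/-- Open cone around the `n`-th triangle. -/
def cone (n : ℕ) : Set (ℝ × ℝ) := {v | v.2 < (n + 1 / 2) * v.1 ∧ (n - 1 / 2) * v.1 < v.2}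

lemma cone_open (n : ℕ) : IsOpen (cone n) := by
  have h1 : IsOpen {v : ℝ × ℝ | v.2 < ((n : ℝ) + 1 / 2) * v.1} :=
    isOpen_lt (by fun_prop) (by fun_prop)
  have h2 : IsOpen {v : ℝ × ℝ | ((n : ℝ) - 1 / 2) * v.1 < v.2} :=
    isOpen_lt (by fun_prop) (by fun_prop)
  exact h1.inter h2

lemma l_pos (s : ℝ) (h0 : 0 < s) (h1 : s < 1) : 0 ≤ l1 s ∧ 0 ≤ l2 s ∧ 0 < l1 s + l2 s := by
  rcases l_cases s h0.le h1.le with ⟨h, e1, e2⟩ | ⟨h, h', e1, e2⟩ | ⟨h, e1, e2⟩ <;> rw [e1, e2] <;>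
    refine ⟨?_, ?_, ?_⟩ <;> linarith

lemma cone_comb (n : ℕ) (hn : 2 ≤ n) (a b : ℝ) (ha : 0 ≤ a) (hb : 0 ≤ b) (hab : 0 < a + b) :
    (a * (1 / n) + b * (1 / n + eps n * n), a + b * (1 - eps n)) ∈ cone n := by
  have h2 : (2 : ℝ) ≤ n := by exact_mod_cast hn
  have he := eps_pos n
  have hs := eps_small n hn
  have e1 : (n : ℝ) * (1 / n) = 1 := by field_simp
  set q : ℝ := 1 / n with hq
  have hqpos : 0 < q := by positivity
  have hεn : 0 < eps n * n := by positivity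
  -- the generators lie in the cone
  have g1 : (1 : ℝ) < (n + 1 / 2) * q := by nlinarith
  have g2 : (n - 1 / 2) * q < 1 := by nlinarith
  have g3 : 1 - eps n < (n + 1 / 2) * (q + eps n * n) := by nlinarith
  have g4 : (n - 1 / 2) * (q + eps n * n) < 1 - eps n := by
    have k1 : eps n * (n * n + 1) < q / 2 := by
      have : n * (eps n * (n * n + 1)) < n * (q / 2) := by
        have : (n : ℝ) * (q / 2) = 1 / 2 := by linarith
        rw [this]
        have k2 : (n : ℝ) ≤ n ^ 3 := le_self_pow₀ (by linarith) (by norm_num)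
        have k3 : (0 : ℝ) < n ^ 3 := by positivity
        nlinarith [mul_le_mul_of_nonneg_left k2 he.le, mul_pos he k3]
      exact lt_of_mul_lt_mul_left this (by linarith)
    nlinarith
  constructor
  · change a + b * (1 - eps n) < (n + 1 / 2) * (a * q + b * (q + eps n * n))
    rcases ha.eq_or_lt with h | h
    · have : 0 < b := by linarith
      subst h; nlinarith
    · nlinarith
  · change (n - 1 / 2) * (a * q + b * (q + eps n * n)) < a + b * (1 - eps n)
    rcases ha.eq_or_lt with h | h
    · have : 0 < b := by linarith
      subst h; nlinarith
    · nlinarith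

lemma tau_cone (n : ℕ) (hn : 2 ≤ n) (s : ℝ) (h0 : 0 < s) (h1 : s < 1) : tau n s ∈ cone n := by
  obtain ⟨h, h', h''⟩ := l_pos s h0 h1
  exact cone_comb n hn _ _ h h' h''

lemma cone_pos (n : ℕ) (v : ℝ × ℝ) (h : v ∈ cone n) : 0 < v.1 := by
  obtain ⟨h1, h2⟩ := h
  linarith

lemma cone_disj_aux (n m : ℕ) (v : ℝ × ℝ) (h : v ∈ cone n) (h' : v ∈ cone m) : ¬ n < m := by
  intro hlt
  have hp := cone_pos n v h
  have : (n : ℝ) + 1 ≤ m := by exact_mod_cast hlt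
  have h1 := h.1
  have h2 := h'.2
  nlinarith

lemma cone_disj (n m : ℕ) (v : ℝ × ℝ) (h : v ∈ cone n) (h' : v ∈ cone m) : n = m := by
  have h1 := cone_disj_aux n m v h h'
  have h2 := cone_disj_aux m n v h' h
  omega

lemma mem_C_iff (n : ℕ) (v : ℝ × ℝ) : v ∈ Cset n ↔ ∃ s, 0 ≤ s ∧ s ≤ 1 ∧ tau n s = v := by
  constructor
  · rintro ((h | h) | h)
    · obtain ⟨a, b, ha, hb, hab, rfl⟩ := h
      refine ⟨b / 3, by linarith, by linarith, ?_⟩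
      obtain ⟨e1, e2⟩ := l_low (b / 3) (by linarith) (by linarith)
      rw [tau_eq, e1, e2]
      have : (3 : ℝ) * (b / 3) = b := by ring
      rw [this]
      simp [pp]
    · obtain ⟨a, b, ha, hb, hab, rfl⟩ := h
      refine ⟨(1 + b) / 3, by linarith, by linarith, ?_⟩
      obtain ⟨e1, e2⟩ := l_mid ((1 + b) / 3) (by linarith) (by linarith)
      rw [tau_eq, e1, e2]
      have h1 : (2 : ℝ) - 3 * ((1 + b) / 3) = a := by linarith
      have h2 : (3 : ℝ) * ((1 + b) / 3) - 1 = b := by ring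
      rw [h1, h2]
    · obtain ⟨a, b, ha, hb, hab, rfl⟩ := h
      refine ⟨(2 + b) / 3, by linarith, by linarith, ?_⟩
      obtain ⟨e1, e2⟩ := l_high ((2 + b) / 3) (by linarith) (by linarith)
      rw [tau_eq, e1, e2]
      have h1 : (3 : ℝ) - 3 * ((2 + b) / 3) = a := by linarith
      rw [h1]
      simp [pp]
  · rintro ⟨s, h0, h1, rfl⟩
    rw [tau_eq]
    rcases l_cases s h0 h1 with ⟨h, e1, e2⟩ | ⟨h, h', e1, e2⟩ | ⟨h, e1, e2⟩ <;> rw [e1, e2]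
    · refine Or.inl (Or.inl ⟨1 - 3 * s, 3 * s, by linarith, by linarith, by ring, ?_⟩)
      simp [pp]
    · exact Or.inl (Or.inr ⟨2 - 3 * s, 3 * s - 1, by linarith, by linarith, by ring, rfl⟩)
    · refine Or.inr ⟨3 - 3 * s, 1 - (3 - 3 * s), by linarith, by linarith, by ring, ?_⟩
      simp [pp]

lemma mem_X_iff (v : ℝ × ℝ) : v ∈ Xset ↔ ∃ n, 2 ≤ n ∧ ∃ s, 0 ≤ s ∧ s ≤ 1 ∧ tau n s = v := by
  simp only [Xset, Set.mem_iUnion, Set.mem_setOf_eq, mem_C_iff, exists_prop]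

lemma tau_zero (n : ℕ) : tau n 0 = pp := by
  obtain ⟨e1, e2⟩ := l_low 0 le_rfl (by norm_num)
  rw [tau, e1, e2]; simp [pp]

lemma tau_one (n : ℕ) : tau n 1 = pp := by
  obtain ⟨e1, e2⟩ := l_high 1 (by norm_num) le_rfl
  rw [tau, e1, e2]; simp [pp]

/-- The functional separating left and right half of the triangle. -/
def dd (n : ℕ) (v : ℝ × ℝ) : ℝ := v.2 * (1 / n + (1 / n + eps n * n)) - v.1 * (1 + (1 - eps n))

lemma dd_tau (n : ℕ) (s : ℝ) : dd n (tau n s) = (l1 s - l2 s) * (eps n * (1 / n + n)) := by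
  simp only [dd, tau]; ring

lemma kk_pos (n : ℕ) (hn : 2 ≤ n) : 0 < eps n * (1 / n + n) := by
  have h2 : (2 : ℝ) ≤ n := by exact_mod_cast hn
  have := eps_pos n
  positivity

lemma l_sub_pos (s : ℝ) (h0 : 0 < s) (h1 : s < 1) : 0 < l1 s - l2 s ↔ s < 1 / 2 := by
  rcases l_cases s h0.le h1.le with ⟨h, e1, e2⟩ | ⟨h, h', e1, e2⟩ | ⟨h, e1, e2⟩ <;> rw [e1, e2] <;>
    constructor <;> intro <;> linarith

lemma l_sub_neg (s : ℝ) (h0 : 0 < s) (h1 : s < 1) : l1 s - l2 s < 0 ↔ 1 / 2 < s := by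
  rcases l_cases s h0.le h1.le with ⟨h, e1, e2⟩ | ⟨h, h', e1, e2⟩ | ⟨h, e1, e2⟩ <;> rw [e1, e2] <;>
    constructor <;> intro <;> linarith

lemma tau_inj (n : ℕ) (hn : 2 ≤ n) (s t : ℝ) (h0 : 0 < s) (h1 : s < 1) (h0' : 0 < t) (h1' : t < 1)
    (h : tau n s = tau n t) : s = t := by
  have k := kk_pos n hn
  have e1 : l1 s - l2 s = l1 t - l2 t := by
    have := congrArg (dd n) h
    rw [dd_tau, dd_tau] at this
    exact mul_right_cancel₀ k.ne' this
  have e2 : l1 s + l2 s * (1 - eps n) = l1 t + l2 t * (1 - eps n) := congrArg Prod.snd h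
  have he := eps_quarter n hn
  have hp := eps_pos n
  have e3 : l2 s = l2 t := by
    have : (l2 s - l2 t) * (2 - eps n) = 0 := by linear_combination e2 - e1
    rcases mul_eq_zero.1 this with h | h <;> linarith
  have e4 : l1 s = l1 t := by linarith
  rcases l_cases s h0.le h1.le with ⟨h, a1, a2⟩ | ⟨h, h', a1, a2⟩ | ⟨h, a1, a2⟩ <;>
  rcases l_cases t h0'.le h1'.le with ⟨h, b1, b2⟩ | ⟨h, h', b1, b2⟩ | ⟨h, b1, b2⟩ <;>
  rw [a1, b1] at e4 <;> rw [a2, b2] at e3 <;> linarith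

/-- The loop around the `n+2`-nd triangle. -/
def tri (n : ℕ) : Path pX pX where
  toFun s := ⟨tau (n + 2) s, (mem_X_iff _).2 ⟨n + 2, by omega, s, s.2.1, s.2.2, rfl⟩⟩
  continuous_toFun := ((tau_cont (n + 2)).comp continuous_subtype_val).subtype_mk _
  source' := Subtype.ext (by simpa using! tau_zero (n + 2))
  target' := Subtype.ext (by simpa using! tau_one (n + 2))

lemma tri_val (n : ℕ) (s : I) : (tri n s : ℝ × ℝ) = tau (n + 2) s := rfl

/-- The neighbourhood of the base point. -/
def nA : Set ↥Xset := {x | (x : ℝ × ℝ).2 < 3 / 4}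

/-- The open arcs. -/
def nV (n : ℕ) : Set ↥Xset := {x | (x : ℝ × ℝ) ∈ cone (n + 2)}

lemma nV_def (n : ℕ) (x : ↥Xset) :
    x ∈ nV n ↔ ∃ s : I, 0 < (s : ℝ) ∧ (s : ℝ) < 1 ∧ tri n s = x := by
  constructor
  · intro h
    obtain ⟨m, hm, s, h0, h1, hs⟩ := (mem_X_iff _).1 x.2
    have hpos := cone_pos _ _ h
    have hs0 : s ≠ 0 := by
      rintro rfl
      rw [← hs, tau_zero] at hpos
      exact lt_irrefl _ hpos
    have hs1 : s ≠ 1 := by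
      rintro rfl
      rw [← hs, tau_one] at hpos
      exact lt_irrefl _ hpos
    have h0' := lt_of_le_of_ne h0 hs0.symm
    have h1' := lt_of_le_of_ne h1 hs1
    have hc := tau_cone m hm s h0' h1'
    rw [hs] at hc
    have := cone_disj _ _ _ hc h
    subst this
    exact ⟨⟨s, h0, h1⟩, h0', h1', Subtype.ext hs⟩
  · rintro ⟨s, h0, h1, rfl⟩
    exact tau_cone (n + 2) (by omega) s h0 h1

lemma y_cases (n : ℕ) (hn : 2 ≤ n) (s : ℝ) (h0 : 0 ≤ s) (h1 : s ≤ 1) (h : (tau n s).2 < 3 / 4) :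
    (s < 1 / 3 ∧ 3 * s < 3 / 4) ∨ (2 / 3 < s ∧ (3 - 3 * s) * (1 - eps n) < 3 / 4) := by
  have he := eps_quarter n hn
  have hp := eps_pos n
  simp only [tau] at h
  rcases l_cases s h0 h1 with ⟨k, e1, e2⟩ | ⟨k, k', e1, e2⟩ | ⟨k, e1, e2⟩ <;> rw [e1, e2] at h
  · left; constructor <;> linarith
  · exfalso; nlinarith
  · right
    refine ⟨?_, by linarith⟩
    rcases k.eq_or_lt with k | k
    · rw [← k] at h; linarith
    · exact k

lemma nA_sc : IsSimplyConnected nA := by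
  rw [← Topology.IsEmbedding.subtypeVal.isSimplyConnected_image]
  have hstar : StarConvex ℝ pp (Subtype.val '' nA) := by
    rw [starConvex_iff_segment_subset]
    rintro v ⟨x, hx, rfl⟩
    rintro w ⟨a, b, ha, hb, hab, rfl⟩
    have hw : a • pp + b • (x : ℝ × ℝ) = b • (x : ℝ × ℝ) := by simp [pp]
    rw [hw]
    have hy : (b • (x : ℝ × ℝ)).2 < 3 / 4 := by
      have hx' : (x : ℝ × ℝ).2 < 3 / 4 := hx
      change b * (x : ℝ × ℝ).2 < 3 / 4
      rcases le_total (x : ℝ × ℝ).2 0 with h | h <;> nlinarith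
    refine ⟨⟨b • (x : ℝ × ℝ), ?_⟩, hy, rfl⟩
    obtain ⟨n, hn, s, h0, h1, hs⟩ := (mem_X_iff _).1 x.2
    have hx' : (tau n s).2 < 3 / 4 := by rw [hs]; exact hx
    rw [← hs, mem_X_iff]
    rcases y_cases n hn s h0 h1 hx' with ⟨k, k'⟩ | ⟨k, k'⟩
    · refine ⟨n, hn, b * s, by positivity, by nlinarith, ?_⟩
      obtain ⟨e1, e2⟩ := l_low s h0 k.le
      obtain ⟨f1, f2⟩ := l_low (b * s) (by positivity) (by nlinarith)
      rw [tau_eq, tau_eq, e1, e2, f1, f2]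
      simp only [zero_smul, add_zero, smul_smul]
      congr 1; ring
    · refine ⟨n, hn, 1 - b * (1 - s), by nlinarith, by nlinarith, ?_⟩
      obtain ⟨e1, e2⟩ := l_high s k.le h1
      obtain ⟨f1, f2⟩ := l_high (1 - b * (1 - s)) (by nlinarith) (by nlinarith)
      rw [tau_eq, tau_eq, e1, e2, f1, f2]
      simp only [zero_smul, zero_add, smul_smul]
      congr 1; ring
  have hne : (Subtype.val '' nA).Nonempty := ⟨pp, pX, by simp [nA, pX, pp], rfl⟩
  have := hstar.contractibleSpace hne
  exact SimplyConnectedSpace.ofContractible _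

lemma nV_sc (n : ℕ) : IsSimplyConnected (nV n) := by
  have hpre : ∀ s : I, s ∈ tri n ⁻¹' nV n ↔ 0 < (s : ℝ) ∧ (s : ℝ) < 1 := by
    intro s
    constructor
    · intro h
      have hpos := cone_pos _ _ h
      rw [tri_val] at hpos
      constructor
      · refine lt_of_le_of_ne s.2.1 ?_
        intro h0
        rw [← h0, tau_zero] at hpos
        exact lt_irrefl _ hpos
      · refine lt_of_le_of_ne s.2.2 ?_
        intro h0
        rw [h0, tau_one] at hpos
        exact lt_irrefl _ hpos
    · rintro ⟨h0, h1⟩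
      exact (nV_def n _).2 ⟨s, h0, h1, rfl⟩
  have h1 : IsSimplyConnected (tri n ⁻¹' nV n) := by
    rw [← Topology.IsEmbedding.subtypeVal.isSimplyConnected_image]
    have : Subtype.val '' (tri n ⁻¹' nV n) = Set.Ioo (0 : ℝ) 1 := by
      ext x
      constructor
      · rintro ⟨s, hs, rfl⟩
        exact (hpre s).1 hs
      · intro hx
        exact ⟨⟨x, hx.1.le, hx.2.le⟩, (hpre _).2 hx, rfl⟩
    rw [this]
    have := (convex_Ioo (0 : ℝ) 1).contractibleSpace ⟨1 / 2, by norm_num, by norm_num⟩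
    exact SimplyConnectedSpace.ofContractible _
  have hclosed : IsClosedMap (tri n) := (tri n).continuous.isClosedMap
  have hcl2 := hclosed.restrictPreimage (nV n)
  have hcont : Continuous ((nV n).restrictPreimage (tri n)) := (tri n).continuous.restrictPreimage
  have hinj : Function.Injective ((nV n).restrictPreimage (tri n)) := by
    rintro ⟨s, hs⟩ ⟨t, ht⟩ h
    have h' : tri n s = tri n t := congrArg Subtype.val h
    have h'' : tau (n + 2) s = tau (n + 2) t := congrArg Subtype.val h'
    have hs' := (hpre s).1 hs
    have ht' := (hpre t).1 ht
    exact Subtype.ext (Subtype.ext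
      (tau_inj (n + 2) (by omega) s t hs'.1 hs'.2 ht'.1 ht'.2 h''))
  have hsurj : Function.Surjective ((nV n).restrictPreimage (tri n)) := by
    rintro ⟨x, hx⟩
    obtain ⟨s, h0, h1, rfl⟩ := (nV_def n x).1 hx
    exact ⟨⟨s, hx⟩, rfl⟩
  have hemb := Topology.IsClosedEmbedding.of_continuous_injective_isClosedMap hcont hinj hcl2
  let e := hemb.isEmbedding.toHomeomorphOfSurjective hsurj
  exact e.symm.toHomotopyEquiv.simplyConnectedSpace_iff.2 h1

/-- The concrete bouquet. -/
def theBouq : Bouq ↥Xset pX where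
  lp := tri
  A := nA
  A_open := isOpen_lt (by fun_prop) (by fun_prop)
  pA := by simp [nA, pX, pp]
  A_sc := nA_sc
  V := nV
  V_def := nV_def
  V_open n := (cone_open (n + 2)).preimage continuous_subtype_val
  V_sc := nV_sc
  V_disj n m x h h' := by
    have := cone_disj _ _ _ h h'
    omega
  cover x := by
    obtain ⟨m, hm, s, h0, h1, hs⟩ := (mem_X_iff _).1 x.2
    by_cases hx : (x : ℝ × ℝ).2 < 3 / 4
    · exact Or.inl hx
    · right
      obtain ⟨k, rfl⟩ := Nat.exists_eq_add_of_le' hm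
      refine ⟨k, (nV_def k x).2 ⟨⟨s, h0, h1⟩, ?_, ?_, Subtype.ext hs⟩⟩
      · refine lt_of_le_of_ne h0 ?_
        rintro rfl
        rw [← hs, tau_zero] at hx
        exact hx (by norm_num [pp])
      · refine lt_of_le_of_ne h1 ?_
        rintro rfl
        rw [← hs, tau_one] at hx
        exact hx (by norm_num [pp])
  inj n s t h0 h1 h0' h1' h :=
    Subtype.ext (tau_inj (n + 2) (by omega) s t h0 h1 h0' h1' (congrArg Subtype.val h))
  L_open n := by
    have : {x : ↥Xset | ∃ s : I, 0 < (s : ℝ) ∧ (s : ℝ) < 1 / 2 ∧ tri n s = x} =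
        {x : ↥Xset | (x : ℝ × ℝ) ∈ cone (n + 2)} ∩ {x : ↥Xset | 0 < dd (n + 2) x} := by
      ext x
      constructor
      · rintro ⟨s, h0, h1, rfl⟩
        refine ⟨(nV_def n _).2 ⟨s, h0, by linarith, rfl⟩, ?_⟩
        change 0 < dd (n + 2) (tau (n + 2) s)
        rw [dd_tau]
        exact mul_pos ((l_sub_pos s h0 (by linarith)).2 h1) (kk_pos (n + 2) (by omega))
      · rintro ⟨h, h'⟩
        obtain ⟨s, h0, h1, rfl⟩ := (nV_def n x).1 h
        refine ⟨s, h0, ?_, rfl⟩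
        change 0 < dd (n + 2) (tau (n + 2) s) at h'
        rw [dd_tau] at h'
        exact (l_sub_pos s h0 h1).1 (pos_of_mul_pos_left h' (kk_pos (n + 2) (by omega)).le)
    rw [this]
    refine ((cone_open (n + 2)).preimage continuous_subtype_val).inter ?_
    exact isOpen_lt (by fun_prop) (by unfold dd; fun_prop)
  R_open n := by
    have : {x : ↥Xset | ∃ s : I, 1 / 2 < (s : ℝ) ∧ (s : ℝ) < 1 ∧ tri n s = x} =
        {x : ↥Xset | (x : ℝ × ℝ) ∈ cone (n + 2)} ∩ {x : ↥Xset | dd (n + 2) x < 0} := by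
      ext x
      constructor
      · rintro ⟨s, h0, h1, rfl⟩
        refine ⟨(nV_def n _).2 ⟨s, by linarith, h1, rfl⟩, ?_⟩
        change dd (n + 2) (tau (n + 2) s) < 0
        rw [dd_tau]
        exact mul_neg_of_neg_of_pos ((l_sub_neg s (by linarith) h1).2 h0) (kk_pos (n + 2) (by omega))
      · rintro ⟨h, h'⟩
        obtain ⟨s, h0, h1, rfl⟩ := (nV_def n x).1 h
        refine ⟨s, ?_, h1, rfl⟩
        change dd (n + 2) (tau (n + 2) s) < 0 at h'
        rw [dd_tau] at h'
        exact (l_sub_neg s h0 h1).1 (neg_of_mul_neg_left h' (kk_pos (n + 2) (by omega)).le)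
    rw [this]
    refine ((cone_open (n + 2)).preimage continuous_subtype_val).inter ?_
    exact isOpen_lt (by unfold dd; fun_prop) (by fun_prop)
  mid n s hs h := by
    rcases y_cases (n + 2) (by omega) s s.2.1 s.2.2 h with ⟨k, -⟩ | ⟨k, -⟩ <;> linarith
  left n s t h hs hts := by
    have hts' : (t : ℝ) ≤ s := hts
    rcases y_cases (n + 2) (by omega) s s.2.1 s.2.2 h with ⟨k, k'⟩ | ⟨k, -⟩
    · obtain ⟨e1, e2⟩ := l_low t t.2.1 (by linarith)
      change (tau (n + 2) t).2 < 3 / 4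
      simp only [tau]
      rw [e1, e2]; linarith
    · linarith
  right n s t h hs hts := by
    have hts' : (s : ℝ) ≤ t := hts
    rcases y_cases (n + 2) (by omega) s s.2.1 s.2.2 h with ⟨k, k'⟩ | ⟨k, k'⟩
    · linarith
    · obtain ⟨e1, e2⟩ := l_high t (by linarith) t.2.2
      change (tau (n + 2) t).2 < 3 / 4
      simp only [tau]
      rw [e1, e2]
      have he := eps_quarter (n + 2) (by omega)
      nlinarith

end geometry

/-- the bouquet `X = ⋃_{n ≥ 2} C_n` has discrete topological
fundamental group, which is moreover a free group on countably infinitely many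
generators (the bijection preserves concatenation). -/
theorem pi1_of_bouquet_discrete_and_free :
    DiscreteTopology (piTop ↥Xset pX) ∧
    ∃ e : piTop ↥Xset pX ≃ FreeGroup ℕ,
      ∀ a b : Path pX pX,
        e (Quotient.mk _ (a.trans b)) = e (Quotient.mk _ a) * e (Quotient.mk _ b) := by
  exact Bouq.main theBouq
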